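/- Suppose 𝒦 ⊆ ℝⁿ and 𝒯 ⊆ ℝⁿ are closed, 𝒰 ⊆ ℝ^m is nonempty and compact, 𝒟 ⊆ ℝⁿ is nonempty, and f : ℝⁿ × ℝ^m → ℝⁿ is continuous. Then for every k ∈ {0, …, t}, the minmax value function J_k : ℝⁿ → ℝ is lower semicontinuous. -/

import Mathlib

/-- Minmax dynamic-programming value functions, indexed by the number of remaining steps:
`Jstep 0 = g_t = 1 - 1_𝒯` and
`Jstep (j+1) x = inf_{u ∈ 𝒰} sup_{w ∈ 𝒟} [ Jstep j (f(x,u) + w) + (1 - 1_𝒦(x)) ]`.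
The value function `J_k` of the horizon-`t` problem is `Jstep (t - k)`. -/
noncomputable def Jstep {n m : ℕ} (f : (Fin n → ℝ) → (Fin m → ℝ) → (Fin n → ℝ))
    (U : Set (Fin m → ℝ)) (D K T : Set (Fin n → ℝ)) : ℕ → (Fin n → ℝ) → ℝ
  | 0 => fun x => 1 - T.indicator (fun _ => (1 : ℝ)) x
  | j + 1 => fun x =>
      sInf ((fun u => sSup ((fun w =>
        Jstep f U D K T j (f x u + w) + (1 - K.indicator (fun _ => (1 : ℝ)) x)) '' D)) '' U)

/-- The infimum over a compact set of a jointly lower semicontinuous function is lower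
semicontinuous in the remaining variable. -/
theorem IsCompact.lowerSemicontinuous_sInf_image {X Y : Type*} [TopologicalSpace X]
    [TopologicalSpace Y] {G : X → Y → ℝ} {U : Set Y} (hU : IsCompact U) (hne : U.Nonempty)
    (hG : LowerSemicontinuous fun p : X × Y => G p.1 p.2) :
    LowerSemicontinuous fun x => sInf (G x '' U) := by
  intro x₀ y hy
  obtain ⟨z, hyz, hz⟩ := exists_between hy
  have hslice : LowerSemicontinuousOn (G x₀) U :=
    (hG.comp (Continuous.prodMk_right x₀)).lowerSemicontinuousOn U
  have hbdd : BddBelow (G x₀ '' U) := hslice.bddBelow_of_isCompact hU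
  have hev : ∀ᶠ x in nhds x₀, ∀ u ∈ U, z < G x u :=
    hU.eventually_forall_of_forall_eventually fun u hu =>
      hG (x₀, u) z (hz.trans_le (csInf_le hbdd (Set.mem_image_of_mem _ hu)))
  filter_upwards [hev] with x hx
  refine hyz.trans_le (le_csInf (hne.image _) ?_)
  rintro _ ⟨u, hu, rfl⟩
  exact (hx u hu).le

theorem IsClosed.lowerSemicontinuous_one_sub_indicator {X : Type*} [TopologicalSpace X]
    {S : Set X} (hS : IsClosed S) :
    LowerSemicontinuous fun x => 1 - S.indicator (fun _ => (1 : ℝ)) x := by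
  have h : (fun x => 1 - S.indicator (fun _ => (1 : ℝ)) x) = Sᶜ.indicator fun _ => (1 : ℝ) := by
    rw [Set.indicator_compl]
    rfl
  rw [h]
  exact hS.isOpen_compl.lowerSemicontinuous_indicator zero_le_one

theorem one_sub_indicator_one_mem_Icc {X : Type*} (S : Set X) (x : X) :
    1 - S.indicator (fun _ => (1 : ℝ)) x ∈ Set.Icc (0 : ℝ) 1 := by
  by_cases hx : x ∈ S <;> simp [hx]

theorem Jstep_mem_Icc {n m : ℕ} (f : (Fin n → ℝ) → (Fin m → ℝ) → (Fin n → ℝ))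
    {U : Set (Fin m → ℝ)} (D K T : Set (Fin n → ℝ)) (hU : U.Nonempty) (hD : D.Nonempty)
    (j : ℕ) (x : Fin n → ℝ) : Jstep f U D K T j x ∈ Set.Icc (0 : ℝ) (j + 1) := by
  induction j generalizing x with
  | zero => simpa [Jstep] using one_sub_indicator_one_mem_Icc T x
  | succ j ih =>
    have hK := one_sub_indicator_one_mem_Icc K x
    have hsup (u : Fin m → ℝ) : sSup ((fun w => Jstep f U D K T j (f x u + w) +
        (1 - K.indicator (fun _ => (1 : ℝ)) x)) '' D) ∈ Set.Icc (0 : ℝ) (j + 1 + 1) := by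
      constructor
      · refine Real.sSup_nonneg ?_
        rintro _ ⟨w, -, rfl⟩
        exact add_nonneg (ih _).1 hK.1
      · refine csSup_le (hD.image _) ?_
        rintro _ ⟨w, -, rfl⟩
        exact add_le_add (ih _).2 hK.2
    rw [Jstep, Nat.cast_succ]
    constructor
    · refine Real.sInf_nonneg ?_
      rintro _ ⟨u, -, rfl⟩
      exact (hsup u).1
    · obtain ⟨u, hu⟩ := hU
      refine (csInf_le ⟨0, ?_⟩ (Set.mem_image_of_mem _ hu)).trans (hsup u).2
      rintro _ ⟨v, -, rfl⟩
      exact (hsup v).1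

theorem lowerSemicontinuous_Jstep {n m : ℕ} {f : (Fin n → ℝ) → (Fin m → ℝ) → (Fin n → ℝ)}
    {U : Set (Fin m → ℝ)} {D K T : Set (Fin n → ℝ)} (hK : IsClosed K) (hT : IsClosed T)
    (hU : U.Nonempty) (hUcpt : IsCompact U) (hD : D.Nonempty)
    (hf : Continuous fun p : (Fin n → ℝ) × (Fin m → ℝ) => f p.1 p.2) (j : ℕ) :
    LowerSemicontinuous (Jstep f U D K T j) := by
  induction j with
  | zero => exact hT.lowerSemicontinuous_one_sub_indicator
  | succ j ih =>
    refine hUcpt.lowerSemicontinuous_sInf_image hU ?_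
    simp only [sSup_image']
    refine lowerSemicontinuous_ciSup (fun p => ⟨j + 1 + 1, ?_⟩) fun w => ?_
    · rintro _ ⟨w, rfl⟩
      exact add_le_add (Jstep_mem_Icc f D K T hU hD j _).2 (one_sub_indicator_one_mem_Icc K _).2
    · exact (ih.comp (hf.add continuous_const)).add
        (hK.lowerSemicontinuous_one_sub_indicator.comp continuous_fst)

/-- if `𝒦, 𝒯` are closed, `𝒰` is nonempty and compact, `𝒟` is nonempty, and
`f` is continuous, then each minmax value function `J_k = Jstep (t - k)`, `k ∈ {0,…,t}`,
is lower semicontinuous. -/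
theorem minmax_value_function_lowerSemicontinuous {n m : ℕ}
    (f : (Fin n → ℝ) → (Fin m → ℝ) → (Fin n → ℝ)) (U : Set (Fin m → ℝ))
    (T K D : Set (Fin n → ℝ))
    (hK : IsClosed K) (hT : IsClosed T)
    (hU : U.Nonempty) (hUcpt : IsCompact U) (hD : D.Nonempty)
    (hf : Continuous fun p : (Fin n → ℝ) × (Fin m → ℝ) => f p.1 p.2)
    (t : ℕ) :
    ∀ k : ℕ, k ≤ t → LowerSemicontinuous (Jstep f U D K T (t - k)) := by
  exact fun k _ => lowerSemicontinuous_Jstep hK hT hU hUcpt hD hf (t - k)
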